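/- arXiv:1406.0017 — 2 statements merged into one kernel-verified Lean document; each statement's English description precedes it below -/
import Mathlib

section
/- Let A and B be disjoint finite alphabets and let L ⊆ AB be a nonempty language of two-letter words such that every letter of A is the first letter of some word of L and every letter of B is the second letter of some word of L. Then there exists an ε-free NFA M recognizing L with |M| = Cov(G_L). -/
open Finset

section GraphDefs

variable {α β : Type*}

/-- `(p.1, p.2)` is a biclique of the bipartite graph `(A, B, E)`. -/
def IsBiclique (A : Finset α) (B : Finset β) (E : Finset (α × β))
    (p : Finset α × Finset β) : Prop :=
  p.1 ⊆ A ∧ p.2 ⊆ B ∧ p.1 ×ˢ p.2 ⊆ E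

/-- `C` is a biclique covering of the bipartite graph `(A, B, E)`. -/
def IsBicliqueCover (A : Finset α) (B : Finset β) (E : Finset (α × β))
    (C : Finset (Finset α × Finset β)) : Prop :=
  (∀ p ∈ C, IsBiclique A B E p) ∧ ∀ e ∈ E, ∃ p ∈ C, e.1 ∈ p.1 ∧ e.2 ∈ p.2

/-- The minimum weight of a biclique covering of the bipartite graph `(A, B, E)`. -/
noncomputable def Cov (A : Finset α) (B : Finset β) (E : Finset (α × β)) : ℕ :=
  sInf {w | ∃ C : Finset (Finset α × Finset β),
    IsBicliqueCover A B E C ∧ w = ∑ p ∈ C, (p.1.card + p.2.card)}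

/-- Vertices available to a rectifier network over classes `α` and `β`:
sources come from `α`, sinks from `β`, and inner nodes are indexed by `ℕ`. -/
abbrev RVert (α β : Type*) := α ⊕ β ⊕ ℕ

/-- A rectifier network realizing the bipartite graph `(A, B, E)`:
a finite DAG whose set of source vertices is (a copy of) `A`, whose set of sink
vertices is (a copy of) `B`, and in which `b` is reachable from `a` iff `(a, b) ∈ E`. -/
structure RectNet (A : Finset α) (B : Finset β) (E : Finset (α × β)) where
  V : Finset (RVert α β)
  Ed : Finset (RVert α β × RVert α β)
  mem_fst : ∀ e ∈ Ed, e.1 ∈ V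
  mem_snd : ∀ e ∈ Ed, e.2 ∈ V
  acyclic : ∀ v, ¬ Relation.TransGen (fun x y => (x, y) ∈ Ed) v v
  memA : ∀ a ∈ A, (Sum.inl a : RVert α β) ∈ V
  memB : ∀ b ∈ B, (Sum.inr (Sum.inl b) : RVert α β) ∈ V
  sources : ∀ v ∈ V, (∀ u, (u, v) ∉ Ed) ↔ ∃ a ∈ A, v = Sum.inl a
  sinks : ∀ v ∈ V, (∀ u, (v, u) ∉ Ed) ↔ ∃ b ∈ B, v = Sum.inr (Sum.inl b)
  realizes : ∀ a ∈ A, ∀ b ∈ B,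
    ((a, b) ∈ E ↔ Relation.ReflTransGen (fun x y => (x, y) ∈ Ed)
      (Sum.inl a) (Sum.inr (Sum.inl b)))

/-- The size of a rectifier network: its number of edges. -/
def RectNet.size {A : Finset α} {B : Finset β} {E : Finset (α × β)}
    (R : RectNet A B E) : ℕ := R.Ed.card

/-- The network has depth at most `k`: there is no directed path with `k + 1` edges. -/
def RectNet.DepthLE {A : Finset α} {B : Finset β} {E : Finset (α × β)}
    (R : RectNet A B E) (k : ℕ) : Prop :=
  ∀ f : ℕ → RVert α β, ∃ i ≤ k, (f i, f (i + 1)) ∉ R.Ed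

/-- The minimum size of a rectifier network realizing `(A, B, E)`. -/
noncomputable def Rect (A : Finset α) (B : Finset β) (E : Finset (α × β)) : ℕ :=
  sInf {n | ∃ R : RectNet A B E, R.size = n}

/-- The minimum size of a rectifier network of depth at most `k` realizing `(A, B, E)`. -/
noncomputable def RectDepth (k : ℕ) (A : Finset α) (B : Finset β) (E : Finset (α × β)) : ℕ :=
  sInf {n | ∃ R : RectNet A B E, R.DepthLE k ∧ R.size = n}

/-- `κ(G)`: the maximum of `|A'|·|B'| / (|A'| + |B'|)` over nonempty bicliques of `(A, B, E)`. -/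
noncomputable def kappa (A : Finset α) (B : Finset β) (E : Finset (α × β)) : ℝ :=
  sSup {h | ∃ p : Finset α × Finset β, IsBiclique A B E p ∧ p.1.Nonempty ∧ p.2.Nonempty ∧
    h = ((p.1.card : ℝ) * (p.2.card : ℝ)) / ((p.1.card : ℝ) + (p.2.card : ℝ))}

end GraphDefs

section NFADefs

variable {σ : Type*}

/-- A nondeterministic finite automaton over the alphabet `σ`, with states drawn from `ℕ`
(the state set is the finite set `states`). Transition labels are `Option σ`, where
`none` stands for `ε`. -/
structure NFA0 (σ : Type*) where
  states : Finset ℕ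
  start : ℕ
  accept : Finset ℕ
  trans : Finset (ℕ × Option σ × ℕ)
  start_mem : start ∈ states
  accept_sub : accept ⊆ states
  trans_fst : ∀ t ∈ trans, t.1 ∈ states
  trans_snd : ∀ t ∈ trans, t.2.2 ∈ states

/-- An NFA is `ε`-free if none of its transitions is labelled `ε`. -/
def NFA0.EpsFree (M : NFA0 σ) : Prop := ∀ t ∈ M.trans, t.2.1 ≠ none

/-- The size of an NFA: its number of transitions. -/
def NFA0.size (M : NFA0 σ) : ℕ := M.trans.card

/-- One step of a run: a configuration is a state together with the input yet to be read;
an `ε`-transition leaves the input unchanged, a `some a`-transition consumes the letter `a`. -/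
def NFA0.Step (M : NFA0 σ) : ℕ × List σ → ℕ × List σ → Prop := fun p q =>
  ((p.1, (none : Option σ), q.1) ∈ M.trans ∧ p.2 = q.2) ∨
    ∃ a, (p.1, some a, q.1) ∈ M.trans ∧ p.2 = a :: q.2

/-- The language recognized by an NFA: the words labelling accepting runs. -/
def NFA0.Lang (M : NFA0 σ) : Set (List σ) :=
  {w | ∃ qf ∈ M.accept, Relation.ReflTransGen M.Step (M.start, w) (qf, [])}

end NFADefs

/-- The language `{ab : (a, b) ∈ E} ⊆ AB` of two-letter words associated with the edge set
`E` of a bipartite graph, over the (disjoint) union alphabet `α ⊕ β`. -/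
def TwoLetterLang {α β : Type*} (E : Finset (α × β)) : Set (List (α ⊕ β)) :=
  {w | ∃ p ∈ E, w = [Sum.inl p.1, Sum.inr p.2]}

section CoverNFA

open Classical

variable {α β : Type*}

theorem IsBicliqueCover.singletons {A : Finset α} {B : Finset β} {E : Finset (α × β)}
    (hE : E ⊆ A ×ˢ B) :
    IsBicliqueCover A B E (E.image fun e => (({e.1} : Finset α), ({e.2} : Finset β))) := by
  refine ⟨fun p hp => ?_, fun e he => ⟨_, Finset.mem_image_of_mem _ he, by simp, by simp⟩⟩
  obtain ⟨e, he, rfl⟩ := Finset.mem_image.1 hp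
  have hAB := Finset.mem_product.1 (hE he)
  refine ⟨by simpa using hAB.1, by simpa using hAB.2, ?_⟩
  simpa [Finset.singleton_product_singleton] using he

/-- Some biclique covering attains the minimum weight. -/
theorem exists_isBicliqueCover_weight_eq_cov {A : Finset α} {B : Finset β}
    {E : Finset (α × β)} (hE : E ⊆ A ×ˢ B) :
    ∃ C, IsBicliqueCover A B E C ∧ Cov A B E = ∑ p ∈ C, (p.1.card + p.2.card) :=
  Nat.sInf_mem (s := {w | ∃ C : Finset (Finset α × Finset β),
    IsBicliqueCover A B E C ∧ w = ∑ p ∈ C, (p.1.card + p.2.card)})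
    ⟨_, _, IsBicliqueCover.singletons hE, rfl⟩

/-- The transition given by a member `p` of a covering and a vertex of `p`, where `f p + 2`
is the state representing `p`. -/
def coverTransition (f : Finset α × Finset β → ℕ)
    (x : Σ _ : Finset α × Finset β, α ⊕ β) : ℕ × Option (α ⊕ β) × ℕ :=
  x.2.elim (fun a => (0, some (Sum.inl a), f x.1 + 2))
    (fun b => (f x.1 + 2, some (Sum.inr b), 1))

/-- The transitions of the automaton with one intermediate state per member of `C`. -/
noncomputable def coverTrans (C : Finset (Finset α × Finset β)) (f : Finset α × Finset β → ℕ) :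
    Finset (ℕ × Option (α ⊕ β) × ℕ) :=
  (C.sigma fun p => p.1.disjSum p.2).image (coverTransition f)

theorem mem_coverTrans {C : Finset (Finset α × Finset β)} {f : Finset α × Finset β → ℕ}
    {t : ℕ × Option (α ⊕ β) × ℕ} :
    t ∈ coverTrans C f ↔ ∃ p ∈ C, (∃ a ∈ p.1, t = (0, some (Sum.inl a), f p + 2)) ∨
      ∃ b ∈ p.2, t = (f p + 2, some (Sum.inr b), 1) := by
  simp only [coverTrans, Finset.mem_image, Finset.mem_sigma]
  constructor
  · rintro ⟨⟨p, a | b⟩, ⟨hp, hx⟩, rfl⟩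
    · exact ⟨p, hp, .inl ⟨a, by simpa using hx, rfl⟩⟩
    · exact ⟨p, hp, .inr ⟨b, by simpa using hx, rfl⟩⟩
  · rintro ⟨p, hp, ⟨a, ha, rfl⟩ | ⟨b, hb, rfl⟩⟩
    · exact ⟨⟨p, .inl a⟩, ⟨hp, by simpa using ha⟩, rfl⟩
    · exact ⟨⟨p, .inr b⟩, ⟨hp, by simpa using hb⟩, rfl⟩

theorem card_coverTrans {C : Finset (Finset α × Finset β)} {f : Finset α × Finset β → ℕ}
    (hf : Set.InjOn f (C : Set (Finset α × Finset β))) :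
    (coverTrans C f).card = ∑ p ∈ C, (p.1.card + p.2.card) := by
  rw [coverTrans, Finset.card_image_of_injOn, Finset.card_sigma]
  · simp only [Finset.card_disjSum]
  · rintro ⟨p, x⟩ hx ⟨q, y⟩ hy h
    have hp : p ∈ C := (Finset.mem_sigma.1 hx).1
    have hq : q ∈ C := (Finset.mem_sigma.1 hy).1
    rcases x with a | b <;> rcases y with a' | b' <;>
      simp [coverTransition] at h
    · obtain ⟨rfl, h⟩ := h
      rw [hf hp hq h]
    · obtain ⟨h, rfl⟩ := h
      rw [hf hp hq h]

/-- The automaton with initial state `0`, accepting state `1` and one intermediate state per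
member `(A', B')` of `C`, entered by the letters of `A'` and left by the letters of `B'`. -/
noncomputable def coverNFA (C : Finset (Finset α × Finset β)) (f : Finset α × Finset β → ℕ) :
    NFA0 (α ⊕ β) where
  states := insert 0 (insert 1 (C.image fun p => f p + 2))
  start := 0
  accept := {1}
  trans := coverTrans C f
  start_mem := by simp
  accept_sub := by simp
  trans_fst t ht := by
    obtain ⟨p, hp, ⟨a, -, rfl⟩ | ⟨b, -, rfl⟩⟩ := mem_coverTrans.1 ht
    · simp
    · simpa using ⟨p.1, p.2, hp, rfl⟩
  trans_snd t ht := by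
    obtain ⟨p, hp, ⟨a, -, rfl⟩ | ⟨b, -, rfl⟩⟩ := mem_coverTrans.1 ht
    · simpa using ⟨p.1, p.2, hp, rfl⟩
    · simp

theorem coverNFA_epsFree (C : Finset (Finset α × Finset β)) (f : Finset α × Finset β → ℕ) :
    (coverNFA C f).EpsFree := by
  intro t ht
  obtain ⟨p, -, ⟨a, -, rfl⟩ | ⟨b, -, rfl⟩⟩ := mem_coverTrans.1 ht <;> simp

theorem coverNFA_step {C : Finset (Finset α × Finset β)} {f : Finset α × Finset β → ℕ}
    {q r : ℕ} {w v : List (α ⊕ β)} :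
    (coverNFA C f).Step (q, w) (r, v) ↔ ∃ p ∈ C,
      (∃ a ∈ p.1, q = 0 ∧ r = f p + 2 ∧ w = Sum.inl a :: v) ∨
      ∃ b ∈ p.2, q = f p + 2 ∧ r = 1 ∧ w = Sum.inr b :: v := by
  constructor
  · rintro (⟨h, -⟩ | ⟨x, h, hw⟩)
    · exact absurd rfl (coverNFA_epsFree C f _ h)
    · obtain ⟨p, hp, ⟨a, ha, h⟩ | ⟨b, hb, h⟩⟩ := mem_coverTrans.1 h <;>
        simp only [Prod.mk.injEq, Option.some.injEq] at h <;>
        obtain ⟨rfl, rfl, rfl⟩ := h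
      · exact ⟨p, hp, .inl ⟨a, ha, rfl, rfl, hw⟩⟩
      · exact ⟨p, hp, .inr ⟨b, hb, rfl, rfl, hw⟩⟩
  · rintro ⟨p, hp, ⟨a, ha, rfl, rfl, rfl⟩ | ⟨b, hb, rfl, rfl, rfl⟩⟩
    · exact .inr ⟨_, mem_coverTrans.2 ⟨p, hp, .inl ⟨a, ha, rfl⟩⟩, rfl⟩
    · exact .inr ⟨_, mem_coverTrans.2 ⟨p, hp, .inr ⟨b, hb, rfl⟩⟩, rfl⟩

theorem coverNFA_lang {A : Finset α} {B : Finset β} {E : Finset (α × β)}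
    {C : Finset (Finset α × Finset β)} {f : Finset α × Finset β → ℕ}
    (hC : IsBicliqueCover A B E C) (hf : Set.InjOn f (C : Set (Finset α × Finset β))) :
    (coverNFA C f).Lang = TwoLetterLang E := by
  ext w
  constructor
  · rintro ⟨qf, hqf, h⟩
    obtain rfl : qf = 1 := Finset.mem_singleton.1 hqf
    change Relation.ReflTransGen (coverNFA C f).Step (0, w) (1, []) at h
    obtain h | ⟨⟨q, v⟩, h₁, hv⟩ := h.cases_head
    · simp at h
    obtain ⟨p, hp, ⟨a, ha, -, rfl, rfl⟩ | ⟨b, -, h0, -⟩⟩ := coverNFA_step.1 h₁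
    swap
    · omega
    obtain h | ⟨⟨q, u⟩, h₂, hu⟩ := hv.cases_head
    · simp at h
    obtain ⟨p', hp', ⟨a', -, h0, -⟩ | ⟨b, hb, hpp, rfl, rfl⟩⟩ := coverNFA_step.1 h₂
    · omega
    obtain rfl : p = p' := hf hp hp' (by omega)
    obtain h | ⟨⟨q, t⟩, h₃, -⟩ := hu.cases_head
    · obtain rfl : u = [] := congrArg Prod.snd h
      exact ⟨(a, b), (hC.1 p hp).2.2 (Finset.mk_mem_product ha hb), rfl⟩
    · obtain ⟨p', -, ⟨a', -, h0, -⟩ | ⟨b', -, h0, -⟩⟩ := coverNFA_step.1 h₃ <;> omega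
  · rintro ⟨e, he, rfl⟩
    obtain ⟨p, hp, ha, hb⟩ := hC.2 e he
    exact ⟨1, Finset.mem_singleton_self 1,
      .head (coverNFA_step.2 ⟨p, hp, .inl ⟨e.1, ha, rfl, rfl, rfl⟩⟩)
        (.single (coverNFA_step.2 ⟨p, hp, .inr ⟨e.2, hb, rfl, rfl, rfl⟩⟩))⟩

end CoverNFA

/-- for a nonempty language `L ⊆ AB` of two-letter words over disjoint
alphabets `A` and `B` in which every letter of `A` (resp. `B`) occurs as a first
(resp. second) letter, there exists an `ε`-free NFA `M` recognizing `L` with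
`|M| = Cov(G_L)`. -/
theorem exists_epsfree_nfa_size_eq_cov {α β : Type*} (A : Finset α) (B : Finset β)
    (E : Finset (α × β)) (hE : E ⊆ A ×ˢ B) (hne : E.Nonempty)
    (hA : ∀ a ∈ A, ∃ b, (a, b) ∈ E) (hB : ∀ b ∈ B, ∃ a, (a, b) ∈ E) :
    ∃ M : NFA0 (α ⊕ β), M.EpsFree ∧ M.Lang = TwoLetterLang E ∧
      M.size = Cov A B E := by
  obtain ⟨C, hC, hw⟩ := exists_isBicliqueCover_weight_eq_cov hE
  obtain ⟨f, hf⟩ := Set.countable_iff_exists_injOn.1 C.countable_toSet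
  exact ⟨coverNFA C f, coverNFA_epsFree C f, coverNFA_lang hC hf,
    (card_coverTrans hf).trans hw.symm⟩
end

section
/- For every real ε with 0 < ε < 1/2 there exists a constant c > 0 such that for infinitely many positive integers n there exist a finite alphabet Σ and a language L ⊆ Σ* consisting only of two-letter words with the following properties: L is recognized by some NFA (with ε-transitions allowed) having at most n transitions, and every ε-free NFA recognizing L has at least c·n^{3/2−ε} transitions. -/
/-- A rectifier network with vertex set `Q`, edge set `D`, inputs `i` and outputs `o` yields an
NFA with `ε`-transitions for the reachability relation between inputs and outputs. -/
theorem exists_nfa_of_network {α β Q : Type} [Fintype α] [Fintype β] [Fintype Q]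
    (D : Finset (Q × Q)) (i : α → Q) (o : β → Q) (E : Finset (α × β))
    (hE : ∀ a b, (a, b) ∈ E ↔ Relation.ReflTransGen (fun p q => (p, q) ∈ D) (i a) (o b)) :
    ∃ M : NFA0 (α ⊕ β), M.Lang = TwoLetterLang E ∧
      M.size ≤ D.card + Fintype.card α + Fintype.card β := by
  classical
  obtain ⟨e, he⟩ : ∃ e : Q → ℕ, Function.Injective e :=
    ⟨fun q => Fintype.equivFin Q q, fun p q h =>
      (Fintype.equivFin Q).injective (Fin.ext h)⟩
  let T₁ : Finset (ℕ × Option (α ⊕ β) × ℕ) :=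
    D.image fun d => (e d.1 + 2, none, e d.2 + 2)
  let T₂ : Finset (ℕ × Option (α ⊕ β) × ℕ) :=
    Finset.univ.image fun a : α => (0, some (Sum.inl a), e (i a) + 2)
  let T₃ : Finset (ℕ × Option (α ⊕ β) × ℕ) :=
    Finset.univ.image fun b : β => (e (o b) + 2, some (Sum.inr b), 1)
  let M : NFA0 (α ⊕ β) :=
    { states := insert 0 (insert 1 (Finset.univ.image fun q => e q + 2))
      start := 0
      accept := {1}
      trans := T₁ ∪ T₂ ∪ T₃
      start_mem := by simp
      accept_sub := by simp
      trans_fst := by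
        intro t ht
        simp only [T₁, T₂, T₃, Finset.mem_union, Finset.mem_image] at ht
        rcases ht with (⟨d, _, rfl⟩ | ⟨a, _, rfl⟩) | ⟨b, _, rfl⟩ <;> simp
      trans_snd := by
        intro t ht
        simp only [T₁, T₂, T₃, Finset.mem_union, Finset.mem_image] at ht
        rcases ht with (⟨d, _, rfl⟩ | ⟨a, _, rfl⟩) | ⟨b, _, rfl⟩ <;> simp }
  have mem_trans : ∀ t, t ∈ M.trans ↔
      (∃ d ∈ D, (e d.1 + 2, none, e d.2 + 2) = t) ∨
      (∃ a, (0, some (Sum.inl a), e (i a) + 2) = t) ∨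
      (∃ b, (e (o b) + 2, some (Sum.inr b), 1) = t) := by
    intro t
    simp [M, T₁, T₂, T₃]
  refine ⟨M, ?_, ?_⟩
  · ext w
    constructor
    · rintro ⟨qf, hqf, hrun⟩
      obtain rfl : qf = 1 := by simpa [M] using hqf
      let P : ℕ × List (α ⊕ β) → Prop := fun c =>
        (c.1 = 0 → ∃ a b, Relation.ReflTransGen (fun p q => (p, q) ∈ D) (i a) (o b) ∧
          c.2 = [Sum.inl a, Sum.inr b]) ∧
        (c.1 = 1 → c.2 = []) ∧
        (∀ q, c.1 = e q + 2 → ∃ b, Relation.ReflTransGen (fun p q => (p, q) ∈ D) q (o b) ∧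
          c.2 = [Sum.inr b])
      have hP : P (0, w) := by
        refine Relation.ReflTransGen.head_induction_on (motive := fun c _ => P c) hrun ?_ ?_
        · exact ⟨by simp, by simp, by intro q hq; simp at hq⟩
        · rintro ⟨s, u⟩ ⟨s', u'⟩ hstep - ⟨-, h1, h2⟩
          simp only [NFA0.Step, mem_trans] at hstep
          rcases hstep with ⟨ht, rfl⟩ | ⟨a, ht, rfl⟩
          · rcases ht with ⟨d, hd, hdt⟩ | ⟨a, ha⟩ | ⟨b, hb⟩
            · simp only [Prod.mk.injEq, true_and] at hdt
              obtain ⟨rfl, rfl⟩ := hdt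
              refine ⟨by simp, by simp, fun q hq => ?_⟩
              obtain rfl : d.1 = q := he (by simpa using hq)
              obtain ⟨b, hb, hu⟩ := h2 d.2 rfl
              exact ⟨b, hb.head hd, hu⟩
            · simp at ha
            · simp at hb
          · rcases ht with ⟨d, hd, hdt⟩ | ⟨a, ha⟩ | ⟨b, hb⟩
            · simp at hdt
            · simp only [Prod.mk.injEq, Option.some.injEq] at ha
              obtain ⟨rfl, rfl, rfl⟩ := ha
              refine ⟨fun _ => ?_, by simp, by simp⟩
              obtain ⟨b, hb, hu⟩ := h2 _ rfl
              simp only at hu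
              exact ⟨a, b, hb, by simp [hu]⟩
            · simp only [Prod.mk.injEq, Option.some.injEq] at hb
              obtain ⟨rfl, rfl, rfl⟩ := hb
              refine ⟨by simp, by simp, fun q hq => ?_⟩
              obtain rfl : o b = q := he (by simpa using hq)
              have hu := h1 rfl
              simp only at hu
              exact ⟨b, .refl, by simp [hu]⟩
      obtain ⟨a, b, hab, rfl⟩ := hP.1 rfl
      exact ⟨(a, b), (hE a b).2 hab, rfl⟩
    · rintro ⟨⟨a, b⟩, hab, rfl⟩
      refine ⟨1, by simp [M], ?_⟩
      have hmid : Relation.ReflTransGen M.Step (e (i a) + 2, [Sum.inr b])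
          (e (o b) + 2, [Sum.inr b]) :=
        ((hE a b).1 hab).lift (fun q => (e q + 2, [Sum.inr b]))
          fun p q hpq => Or.inl ⟨(mem_trans _).2 (Or.inl ⟨(p, q), hpq, rfl⟩), rfl⟩
      refine Relation.ReflTransGen.head (b := (e (i a) + 2, [Sum.inr b])) ?_ (hmid.tail ?_)
      · exact Or.inr ⟨_, (mem_trans _).2 (Or.inr (Or.inl ⟨a, rfl⟩)), rfl⟩
      · exact Or.inr ⟨_, (mem_trans _).2 (Or.inr (Or.inr ⟨b, rfl⟩)), rfl⟩
  · have h1 : T₁.card ≤ D.card := Finset.card_image_le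
    have h2 : T₂.card ≤ Fintype.card α := Finset.card_image_le
    have h3 : T₃.card ≤ Fintype.card β := Finset.card_image_le
    have h4 := Finset.card_union_le (T₁ ∪ T₂) T₃
    have h5 := Finset.card_union_le T₁ T₂
    change (T₁ ∪ T₂ ∪ T₃).card ≤ _
    omega

/-- The `k`-fold tensor power of a relation on `W` is computed by a layered network which handles
one coordinate per layer. -/
theorem exists_nfa_of_pi_relation {W : Type} [Fintype W] (k : ℕ) (R : W → W → Prop)
    (E : Finset ((Fin k → W) × (Fin k → W))) (hE : ∀ x y, (x, y) ∈ E ↔ ∀ j, R (x j) (y j)) :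
    ∃ M : NFA0 ((Fin k → W) ⊕ (Fin k → W)), M.Lang = TwoLetterLang E ∧
      M.size ≤ k * Fintype.card W ^ (k + 1) + 2 * Fintype.card W ^ k := by
  classical
  let f : Fin k × (Fin k → W) × W → (Fin (k + 1) × (Fin k → W)) × (Fin (k + 1) × (Fin k → W)) :=
    fun t => ((t.1.castSucc, t.2.1), (t.1.succ, Function.update t.2.1 t.1 t.2.2))
  let D := (Finset.univ.filter fun t : Fin k × (Fin k → W) × W => R (t.2.1 t.1) t.2.2).image f
  have hD : D.card ≤ k * Fintype.card W ^ (k + 1) := by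
    refine Finset.card_image_le.trans ((Finset.card_le_univ _).trans_eq ?_)
    simp [pow_succ]
  obtain ⟨M, hM, hsize⟩ := exists_nfa_of_network D (fun x => (0, x))
    (fun y => (Fin.last k, y)) E (by
      intro x y
      rw [hE]
      constructor
      · intro h
        have key : ∀ i : Fin (k + 1), Relation.ReflTransGen (fun p q => (p, q) ∈ D) (0, x)
            (i, fun j => if j.castSucc < i then y j else x j) := by
          intro i
          induction i using Fin.induction with
          | zero => simpa using Relation.ReflTransGen.refl
          | succ i ih =>
            refine ih.tail (Finset.mem_image.2
              ⟨(i, fun j => if j.castSucc < i.castSucc then y j else x j, y i), ?_, ?_⟩)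
            · simpa using h i
            · simp only [f, Prod.mk.injEq, true_and]
              funext j
              rcases eq_or_ne j i with rfl | hj
              · simp
              · rw [Function.update_of_ne hj]
                have : j.castSucc < i.castSucc ↔ j.castSucc < i.succ := by
                  have : (j : ℕ) ≠ i := fun h => hj (Fin.ext h)
                  simp only [Fin.lt_def, Fin.val_castSucc, Fin.val_succ]
                  omega
                simp only [this]
        simpa [Fin.castSucc_lt_last] using key (Fin.last k)
      · intro h
        have key : ∀ c : Fin (k + 1) × (Fin k → W),
            Relation.ReflTransGen (fun p q => (p, q) ∈ D) (0, x) c →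
            ∀ j : Fin k, (j.castSucc < c.1 → R (x j) (c.2 j)) ∧ (c.1 ≤ j.castSucc → c.2 j = x j) := by
          intro c hc
          induction hc with
          | refl => simp
          | tail _ hstep ih =>
            obtain ⟨⟨i, z, w⟩, ht, hf⟩ := Finset.mem_image.1 hstep
            simp only [f, Prod.mk.injEq] at hf
            obtain ⟨rfl, rfl⟩ := hf
            replace ht : R (z i) w := by simpa using ht
            intro j
            have ihj := ih j
            simp only [Fin.lt_def, Fin.le_def, Fin.val_castSucc, Fin.val_succ] at ihj ⊢
            rcases eq_or_ne j i with rfl | hj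
            · rw [ihj.2 le_rfl] at ht
              simpa using ht
            · have : (j : ℕ) ≠ i := fun h => hj (Fin.ext h)
              rw [Function.update_of_ne hj]
              exact ⟨fun h => ihj.1 (by omega), fun h => ihj.2 (by omega)⟩
        exact fun j => (key _ h j).1 (Fin.castSucc_lt_last j))
  refine ⟨M, hM, hsize.trans ?_⟩
  simp only [Fintype.card_pi, Finset.prod_const, Finset.card_univ, Fintype.card_fin]
  omega

/-- If every complete bipartite subgraph `A × B ⊆ E` satisfies `|A||B| ≤ t²`, then every `ε`-free
NFA for the language of `E` has at least `|E| / (2t)` transitions. -/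
theorem card_le_of_epsFree {α β : Type} [Fintype α] [Fintype β] (E : Finset (α × β)) (t : ℕ)
    (hE : ∀ (A : Finset α) (B : Finset β), A ×ˢ B ⊆ E → A.card * B.card ≤ t * t)
    (M : NFA0 (α ⊕ β)) (hfree : M.EpsFree) (hM : M.Lang = TwoLetterLang E) :
    E.card ≤ 2 * t * M.size := by
  classical
  let A : ℕ → Finset α := fun q => Finset.univ.filter fun a =>
    (M.start, some (Sum.inl a), q) ∈ M.trans
  let B : ℕ → Finset β := fun q => Finset.univ.filter fun b =>
    ∃ qf ∈ M.accept, (q, some (Sum.inr b), qf) ∈ M.trans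
  have hAB : ∀ q, A q ×ˢ B q ⊆ E := by
    rintro q ⟨a, b⟩ hab
    simp only [A, B, Finset.mem_product, Finset.mem_filter, Finset.mem_univ, true_and] at hab
    obtain ⟨ha, qf, hqf, hb⟩ := hab
    have hmem : [Sum.inl a, Sum.inr b] ∈ M.Lang :=
      ⟨qf, hqf, .head (b := (q, [Sum.inr b])) (Or.inr ⟨_, ha, rfl⟩)
        (.single (Or.inr ⟨_, hb, rfl⟩))⟩
    rw [hM] at hmem
    obtain ⟨p, hp, hw⟩ := hmem
    simp only [List.cons.injEq, Sum.inl.injEq, Sum.inr.injEq, and_true] at hw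
    rwa [hw.1, hw.2]
  have step : ∀ {s s' : ℕ} {u v : List (α ⊕ β)}, M.Step (s, u) (s', v) →
      ∃ x, (s, some x, s') ∈ M.trans ∧ u = x :: v := by
    rintro s s' u v (⟨h, -⟩ | h)
    · exact absurd rfl (hfree _ h)
    · exact h
  have hcover : E ⊆ M.states.biUnion fun q => A q ×ˢ B q := by
    rintro ⟨a, b⟩ hab
    have hmem : [Sum.inl a, Sum.inr b] ∈ M.Lang := by
      rw [hM]
      exact ⟨_, hab, rfl⟩
    obtain ⟨qf, hqf, hrun⟩ := hmem
    obtain h | ⟨⟨q, u⟩, h₁, hrun⟩ := hrun.cases_head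
    · simp at h
    obtain ⟨x, hx, hxu⟩ := step h₁
    obtain ⟨rfl, rfl⟩ := List.cons.inj hxu
    obtain h | ⟨⟨q', u⟩, h₂, hrun⟩ := hrun.cases_head
    · simp at h
    obtain ⟨y, hy, hyu⟩ := step h₂
    obtain ⟨rfl, rfl⟩ := List.cons.inj hyu
    obtain h | ⟨⟨q'', u⟩, h₃, -⟩ := hrun.cases_head
    · simp only [Prod.mk.injEq, and_true] at h
      subst h
      simp only [Finset.mem_biUnion, A, B, Finset.mem_product, Finset.mem_filter,
        Finset.mem_univ, true_and]
      exact ⟨q, M.trans_snd _ hx, hx, q', hqf, hy⟩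
    · obtain ⟨z, -, hz⟩ := step h₃
      simp at hz
  have hA : ∑ q ∈ M.states, (A q).card ≤ M.size := by
    rw [NFA0.size, Finset.card_eq_sum_card_fiberwise (fun t ht => M.trans_snd t ht)]
    refine Finset.sum_le_sum fun q _ => Finset.card_le_card_of_injOn
      (fun a => (M.start, some (Sum.inl a), q)) ?_ ?_
    · intro a ha
      simpa [A] using ha
    · intro a _ a' _ h
      simpa using h
  have hB : ∑ q ∈ M.states, (B q).card ≤ M.size := by
    rw [NFA0.size, Finset.card_eq_sum_card_fiberwise (fun t ht => M.trans_fst t ht)]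
    refine Finset.sum_le_sum fun q _ => ?_
    calc (B q).card = ((B q).image fun b => some (Sum.inr b : α ⊕ β)).card :=
          (Finset.card_image_of_injective _
            ((Option.some_injective _).comp Sum.inr_injective)).symm
      _ ≤ ((M.trans.filter fun t => t.1 = q).image fun t => t.2.1).card := by
          refine Finset.card_le_card fun l hl => ?_
          obtain ⟨b, hb, rfl⟩ := Finset.mem_image.1 hl
          simp only [B, Finset.mem_filter, Finset.mem_univ, true_and] at hb
          obtain ⟨qf, -, hqf⟩ := hb
          exact Finset.mem_image.2 ⟨_, Finset.mem_filter.2 ⟨hqf, rfl⟩, rfl⟩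
      _ ≤ _ := Finset.card_image_le
  calc E.card ≤ ∑ q ∈ M.states, (A q ×ˢ B q).card :=
        (Finset.card_le_card hcover).trans Finset.card_biUnion_le
    _ ≤ ∑ q ∈ M.states, t * ((A q).card + (B q).card) := by
        refine Finset.sum_le_sum fun q _ => ?_
        rw [Finset.card_product]
        have := hE _ _ (hAB q)
        rcases le_or_gt (A q).card t with h | h
        · nlinarith
        · have : (B q).card ≤ t := by
            by_contra! h'
            nlinarith
          nlinarith
    _ = t * (∑ q ∈ M.states, (A q).card + ∑ q ∈ M.states, (B q).card) := by
        rw [← Finset.mul_sum, Finset.sum_add_distrib]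
    _ ≤ t * (M.size + M.size) := by gcongr
    _ = 2 * t * M.size := by ring

/-- Orthogonal sets of vectors over a finite field have bounded product of cardinalities. -/
theorem card_mul_card_le_of_dotProduct_eq_zero {K ι : Type} [Field K] [Fintype K] [Fintype ι]
    (A B : Finset (ι → K)) (h : ∀ x ∈ A, ∀ y ∈ B, x ⬝ᵥ y = 0) :
    A.card * B.card ≤ Fintype.card K ^ Fintype.card ι := by
  classical
  let U : Submodule K (ι → K) := Submodule.span K B
  let Φ := dotProductEquiv K ι
  have : Finite (Module.Dual K (ι → K)) := Finite.of_equiv _ Φ.toEquiv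
  have hA : A.card ≤ Nat.card U.dualAnnihilator := by
    rw [← Nat.card_eq_finsetCard A]
    refine Nat.card_le_card_of_injective
      (fun x : A => (⟨Φ x, ?_⟩ : U.dualAnnihilator)) ?_
    · rw [Submodule.mem_dualAnnihilator]
      intro y hy
      induction hy using Submodule.span_induction with
      | mem y hy => exact h x x.2 y hy
      | zero => simp
      | add y z _ _ hy hz => rw [map_add, hy, hz, add_zero]
      | smul c y _ hy => rw [map_smul, hy, smul_zero]
    · intro x y hxy
      exact Subtype.ext (Φ.injective (congrArg Subtype.val hxy))
  have hB : B.card ≤ Nat.card U := by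
    rw [← Nat.card_eq_finsetCard B]
    exact Nat.card_le_card_of_injective
      (fun x : B => (⟨x, Submodule.subset_span x.2⟩ : U))
      fun x y hxy => Subtype.ext (congrArg (fun z : U => (z : ι → K)) hxy)
  have hdim := Subspace.finrank_add_finrank_dualAnnihilator_eq U
  rw [Module.finrank_fintype_fun_eq_card] at hdim
  calc A.card * B.card ≤ Nat.card U.dualAnnihilator * Nat.card U := Nat.mul_le_mul hA hB
    _ = Fintype.card K ^ Fintype.card ι := by
      rw [Module.natCard_eq_pow_finrank (K := K) (V := U),
        Module.natCard_eq_pow_finrank (K := K) (V := U.dualAnnihilator), ← pow_add, add_comm, hdim,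
        Nat.card_eq_fintype_card]

/-- At least half of all vectors over the two-element field are orthogonal to a given one. -/
theorem two_pow_le_two_mul_card_orthogonal {r : ℕ} (v : Fin r → ZMod 2) :
    2 ^ r ≤ 2 * (Finset.univ.filter fun w : Fin r → ZMod 2 => v ⬝ᵥ w = 0).card := by
  classical
  let S := Finset.univ.filter fun w : Fin r → ZMod 2 => v ⬝ᵥ w = 0
  let S' := Finset.univ.filter fun w : Fin r → ZMod 2 => ¬ v ⬝ᵥ w = 0
  have hsum : S.card + S'.card = 2 ^ r := by
    rw [Finset.card_filter_add_card_filter_not]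
    simp
  have hle : S'.card ≤ S.card := by
    rcases S'.eq_empty_or_nonempty with h | ⟨w₀, hw₀⟩
    · simp [h]
    · refine Finset.card_le_card_of_injOn (fun w => w + w₀) ?_ (add_left_injective w₀).injOn
      intro w hw
      have key : ∀ a b : ZMod 2, ¬ a = 0 → ¬ b = 0 → a + b = 0 := by decide
      simp only [S', Finset.coe_filter, Finset.mem_filter, Finset.mem_univ, true_and,
        Set.mem_ofPred_eq] at hw hw₀
      simpa [S, dotProduct_add] using key _ _ hw hw₀
  change 2 ^ r ≤ 2 * S.card
  omega

/-- The pairs of vectors over the two-element field which are blockwise orthogonal. -/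
def blockOrthogonal (r k : ℕ) : Finset ((Fin k → Fin r → ZMod 2) × (Fin k → Fin r → ZMod 2)) :=
  Finset.univ.filter fun p => ∀ j, p.1 j ⬝ᵥ p.2 j = 0

theorem mem_blockOrthogonal {r k : ℕ} (x y : Fin k → Fin r → ZMod 2) :
    (x, y) ∈ blockOrthogonal r k ↔ ∀ j, x j ⬝ᵥ y j = 0 := by
  simp [blockOrthogonal]

theorem card_mul_card_le_of_product_subset_blockOrthogonal {r k : ℕ}
    (A B : Finset (Fin k → Fin r → ZMod 2)) (h : A ×ˢ B ⊆ blockOrthogonal r k) :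
    A.card * B.card ≤ 2 ^ (k * r) := by
  classical
  have hinj : Function.Injective
      (fun (x : Fin k → Fin r → ZMod 2) (p : Fin k × Fin r) => x p.1 p.2) := by
    intro x y hxy
    funext i j
    exact congrFun hxy (i, j)
  rw [← Finset.card_image_of_injective A hinj, ← Finset.card_image_of_injective B hinj]
  refine (card_mul_card_le_of_dotProduct_eq_zero _ _ ?_).trans_eq (by simp [ZMod.card])
  intro x' hx y' hy
  obtain ⟨x, hxA, rfl⟩ := Finset.mem_image.1 hx
  obtain ⟨y, hyB, rfl⟩ := Finset.mem_image.1 hy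
  have hxy := (mem_blockOrthogonal x y).1 (h (Finset.mk_mem_product hxA hyB))
  rw [dotProduct, Fintype.sum_prod_type]
  exact Finset.sum_eq_zero fun i _ => hxy i

theorem two_pow_le_card_blockOrthogonal (r k : ℕ) :
    2 ^ (2 * (k * r)) ≤ 2 ^ k * (blockOrthogonal r k).card := by
  classical
  let S : (Fin r → ZMod 2) → Finset (Fin r → ZMod 2) := fun v =>
    Finset.univ.filter fun w => v ⬝ᵥ w = 0
  have hfib : ∀ x : Fin k → Fin r → ZMod 2,
      2 ^ (k * r) ≤ 2 ^ k * (Fintype.piFinset fun j => S (x j)).card := by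
    intro x
    calc 2 ^ (k * r) = ∏ _j : Fin k, 2 ^ r := by simp [pow_mul']
      _ ≤ ∏ j : Fin k, 2 * (S (x j)).card :=
          Finset.prod_le_prod' fun j _ => two_pow_le_two_mul_card_orthogonal (x j)
      _ = 2 ^ k * (Fintype.piFinset fun j => S (x j)).card := by
          simp [Finset.prod_mul_distrib, Fintype.card_piFinset]
  have hcard : (blockOrthogonal r k).card =
      ∑ x : Fin k → Fin r → ZMod 2, (Fintype.piFinset fun j => S (x j)).card := by
    rw [← Finset.card_sigma]
    refine Finset.card_bij' (fun p _ => ⟨p.1, p.2⟩) (fun p _ => (p.1, p.2)) ?_ ?_ ?_ ?_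
    · rintro ⟨x, y⟩ h
      simpa [S, mem_blockOrthogonal] using h
    · rintro ⟨x, y⟩ h
      simpa [S, mem_blockOrthogonal] using h
    · simp
    · simp
  calc 2 ^ (2 * (k * r)) = ∑ _x : Fin k → Fin r → ZMod 2, 2 ^ (k * r) := by
        simp [two_mul, pow_add, pow_mul']
    _ ≤ ∑ x : Fin k → Fin r → ZMod 2, 2 ^ k * (Fintype.piFinset fun j => S (x j)).card :=
        Finset.sum_le_sum fun x _ => hfib x
    _ = 2 ^ k * (blockOrthogonal r k).card := by rw [hcard, Finset.mul_sum]

theorem two_pow_le_size_of_epsFree (h k : ℕ)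
    (M : NFA0 ((Fin k → Fin (2 * h) → ZMod 2) ⊕ (Fin k → Fin (2 * h) → ZMod 2)))
    (hfree : M.EpsFree) (hM : M.Lang = TwoLetterLang (blockOrthogonal (2 * h) k)) :
    2 ^ (3 * (h * k)) ≤ 2 ^ (k + 1) * M.size := by
  have hle := card_le_of_epsFree (blockOrthogonal (2 * h) k) (2 ^ (h * k)) (fun A B hAB => by
    refine (card_mul_card_le_of_product_subset_blockOrthogonal A B hAB).trans_eq ?_
    rw [← pow_add]
    congr 1
    ring) M hfree hM
  refine Nat.le_of_mul_le_mul_left (c := 2 ^ (h * k)) ?_ (by positivity)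
  calc 2 ^ (h * k) * 2 ^ (3 * (h * k)) = 2 ^ (2 * (k * (2 * h))) := by
        rw [← pow_add]
        congr 1
        ring
    _ ≤ 2 ^ k * (blockOrthogonal (2 * h) k).card := two_pow_le_card_blockOrthogonal _ _
    _ ≤ 2 ^ k * (2 * 2 ^ (h * k) * M.size) := by gcongr
    _ = 2 ^ (h * k) * (2 ^ (k + 1) * M.size) := by ring

theorem rpow_le_of_one_le_mul {ε : ℝ} (hε : 0 < ε) (hε' : ε < 1 / 2) {h : ℕ} (hh : 1 ≤ h * ε)
    (k : ℕ) :
    (((k + 2) * 2 ^ (2 * h * (k + 1)) : ℕ) : ℝ) ^ ((3 : ℝ) / 2 - ε) * 2 ^ (2 * (k + 1)) ≤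
      ((k : ℝ) + 2) ^ 2 * 2 ^ (3 * h * (k + 1)) := by
  push_cast
  rw [Real.mul_rpow (by positivity) (by positivity), mul_assoc]
  refine mul_le_mul ?_ ?_ (by positivity) (by positivity)
  · rw [← Real.rpow_natCast]
    refine Real.rpow_le_rpow_of_exponent_le (by linarith [k.cast_nonneg (α := ℝ)]) ?_
    push_cast
    linarith
  · rw [← Real.rpow_natCast, ← Real.rpow_natCast, ← Real.rpow_natCast,
      ← Real.rpow_mul (by norm_num), ← Real.rpow_add (by norm_num)]
    refine Real.rpow_le_rpow_of_exponent_le (by norm_num) ?_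
    push_cast
    nlinarith [mul_le_mul_of_nonneg_right hh (by positivity : (0 : ℝ) ≤ k + 1)]

theorem sq_add_two_le_two_pow (k : ℕ) : (k + 2) ^ 2 ≤ 8 * 2 ^ k := by
  induction k with
  | zero => norm_num
  | succ k ih =>
    rcases Nat.lt_or_ge k 1 with h | h
    · interval_cases k
      norm_num
    · rw [pow_succ 2 k]
      nlinarith

/-- for every `0 < ε < 1/2` there is a constant `c > 0` such that for
infinitely many positive integers `n` there are a finite alphabet `Σ` and a language
`L ⊆ Σ*` of two-letter words recognized by an NFA (with `ε`-transitions) of size at most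
`n`, while every `ε`-free NFA recognizing `L` has size at least `c · n^(3/2 - ε)`. -/
theorem epsilon_removal_blowup :
    ∀ ε : ℝ, 0 < ε → ε < 1 / 2 →
      ∃ c : ℝ, 0 < c ∧ ∀ N : ℕ, ∃ n : ℕ, N ≤ n ∧ 0 < n ∧
        ∃ (σ : Type) (_ : Fintype σ) (L : Set (List σ)),
          (∀ w ∈ L, w.length = 2) ∧
          (∃ M : NFA0 σ, M.Lang = L ∧ M.size ≤ n) ∧
          (∀ M : NFA0 σ, M.EpsFree → M.Lang = L →
            c * (n : ℝ) ^ ((3 : ℝ) / 2 - ε) ≤ (M.size : ℝ)) := by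
  intro ε hε hε'
  obtain ⟨h, hh⟩ := exists_nat_ge (1 / ε)
  rw [div_le_iff₀ hε] at hh
  refine ⟨1 / (4 * 2 ^ (3 * h)), by positivity, fun k => ⟨(k + 2) * 2 ^ (2 * h * (k + 1)),
    ?_, by positivity, _, inferInstance, TwoLetterLang (blockOrthogonal (2 * h) k), ?_, ?_, ?_⟩⟩
  · have : 1 ≤ 2 ^ (2 * h * (k + 1)) := Nat.one_le_two_pow
    nlinarith
  · rintro w ⟨p, -, rfl⟩
    rfl
  · obtain ⟨M, hM, hsize⟩ := exists_nfa_of_pi_relation k (fun v w : Fin (2 * h) → ZMod 2 =>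
      v ⬝ᵥ w = 0) (blockOrthogonal (2 * h) k) mem_blockOrthogonal
    refine ⟨M, hM, hsize.trans ?_⟩
    have hcard : Fintype.card (Fin (2 * h) → ZMod 2) = 2 ^ (2 * h) := by simp
    rw [hcard, ← pow_mul, ← pow_mul, add_mul]
    gcongr <;> omega
  · intro M hfree hM
    have hlow := two_pow_le_size_of_epsFree h k M hfree hM
    have hlow' : (2 : ℝ) ^ (3 * (h * k)) ≤ 2 ^ (k + 1) * M.size := by exact_mod_cast hlow
    have hup := rpow_le_of_one_le_mul hε hε' hh k
    have hsq : ((k : ℝ) + 2) ^ 2 ≤ 8 * 2 ^ k := by exact_mod_cast sq_add_two_le_two_pow k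
    rw [one_div_mul_eq_div, div_le_iff₀ (by positivity)]
    refine le_of_mul_le_mul_right (hup.trans ?_) (by positivity : (0 : ℝ) < 2 ^ (2 * (k + 1)))
    calc ((k : ℝ) + 2) ^ 2 * 2 ^ (3 * h * (k + 1))
        ≤ 8 * 2 ^ k * 2 ^ (3 * h * (k + 1)) := by gcongr
      _ = 8 * 2 ^ k * 2 ^ (3 * h) * 2 ^ (3 * (h * k)) := by ring
      _ ≤ 8 * 2 ^ k * 2 ^ (3 * h) * (2 ^ (k + 1) * M.size) := by gcongr
      _ = M.size * (4 * 2 ^ (3 * h)) * 2 ^ (2 * (k + 1)) := by ring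
end
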